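/- arXiv:1005.0173 — 3 statements merged into one kernel-verified Lean document; each statement's English description precedes it below -/
import Mathlib

section
/- For every integer n ≥ 1, every binary word w of length n, and every κ > 0, there exists ε = ε(κ,w) > 0 such that the set A_{κ,w} ⊆ [0,1) of κ,w-atypical points has Hausdorff dimension at most 1 − ε. -/
/-- Number of occurrences of the word `w` (of length `n`) in the word `v` (of length `N`). -/
noncomputable def occCount (N n : ℕ) (v : Fin N → Bool) (w : Fin n → Bool) : ℕ :=
  Nat.card {i : ℕ // i + n ≤ N ∧ ∀ (j : Fin n) (h : i + (j : ℕ) < N), v ⟨i + (j : ℕ), h⟩ = w j}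

/-- The `i`-th binary digit of `x ∈ [0,1)`: `ω_i(x) = ⌊2^(i+1) x⌋ mod 2`. -/
noncomputable def binDigit (i : ℕ) (x : ℝ) : Bool :=
  decide (⌊(2 : ℝ) ^ (i + 1) * x⌋ % 2 = 1)

/-- `a_k(x, w)`: the frequency of occurrences of `w` among the first `k` binary digits of `x`. -/
noncomputable def freq (n k : ℕ) (w : Fin n → Bool) (x : ℝ) : ℝ :=
  (occCount k n (fun i : Fin k => binDigit (i : ℕ) x) w : ℝ) / k

/-- A point `x` is `κ,w`-atypical if the sequence `(a_k(x,w))_k` has a limit (accumulation)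
point outside the interval `[2⁻ⁿ - κ, 2⁻ⁿ + κ]`. -/
def IsAtypicalPt (n : ℕ) (κ : ℝ) (w : Fin n → Bool) (x : ℝ) : Prop :=
  ∃ c : ℝ, c ∉ Set.Icc ((1 / 2 : ℝ) ^ n - κ) ((1 / 2 : ℝ) ^ n + κ) ∧
    MapClusterPt c Filter.atTop (fun k : ℕ => freq n k w x)

open Finset in
theorem sum_range_mul_mod_mul_div (B M : ℕ) (g H : ℕ → ℝ) :
    ∑ j ∈ range (B * M), g (j % B) * H (j / B) = (∑ u ∈ range B, g u) * ∑ j ∈ range M, H j := by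
  induction M with
  | zero => simp
  | succ M ih =>
    rw [Nat.mul_succ, sum_range_add, ih, sum_range_succ, mul_add, sum_mul (range B) g (H M)]
    congr 1
    refine sum_congr rfl fun u hu => ?_
    have hu := mem_range.1 hu
    rw [Nat.mul_add_mod, Nat.mod_eq_of_lt hu, Nat.mul_add_div (by omega),
      Nat.div_eq_of_lt hu, add_zero]

open Finset in
theorem sum_range_prod_digits (B Q M : ℕ) (g : ℕ → ℝ) :
    ∑ j ∈ range (B ^ Q * M), ∏ q ∈ range Q, g (j / B ^ q % B) = (∑ u ∈ range B, g u) ^ Q * M := by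
  induction Q with
  | zero => simp
  | succ Q ih =>
    have h := sum_range_mul_mod_mul_div B (B ^ Q * M) g
      fun j => ∏ q ∈ range Q, g (j / B ^ q % B)
    rw [ih] at h
    rw [pow_succ', mul_assoc, pow_succ', mul_assoc, ← h]
    refine sum_congr rfl fun j _ => ?_
    rw [prod_range_succ', mul_comm]
    simp [pow_succ', Nat.div_div_eq_div_mul]

open Finset in
theorem sum_exp_mul_le {ι : Type*} (s : Finset ι) {f : ι → ℝ} (hf : ∀ u ∈ s, |f u| ≤ 1)
    (hf0 : ∑ u ∈ s, f u = 0) {t : ℝ} (ht0 : 0 ≤ t) (ht1 : t ≤ 1) :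
    ∑ u ∈ s, Real.exp (t * f u) ≤ s.card * Real.exp (t ^ 2) := by
  have key : ∀ u ∈ s, Real.exp (t * f u) ≤ 1 + t ^ 2 + t * f u := by
    intro u hu
    have h1 := abs_le.1 (hf u hu)
    have h2 : |t * f u| ≤ 1 := by
      rw [abs_mul, abs_of_nonneg ht0]
      exact mul_le_one₀ ht1 (abs_nonneg _) (hf u hu)
    have h3 := (abs_le.1 (Real.abs_exp_sub_one_sub_id_le h2)).2
    have h4 : f u ^ 2 ≤ 1 := (sq_le_one_iff_abs_le_one _).2 (hf u hu)
    nlinarith [mul_le_mul_of_nonneg_left h4 (sq_nonneg t)]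
  calc _ ≤ ∑ u ∈ s, (1 + t ^ 2 + t * f u) := sum_le_sum key
    _ = s.card * (t ^ 2 + 1) := by
      rw [sum_add_distrib, ← mul_sum, hf0, sum_const, nsmul_eq_mul]; ring
    _ ≤ _ := by gcongr; exact Real.add_one_le_exp _

open Finset in
theorem sum_range_exp_sum_digits_le {n k r : ℕ} (hn : 1 ≤ n) (hr : r < n) (hk : n ≤ k)
    {f : ℕ → ℝ} (hf : ∀ u < 2 ^ n, |f u| ≤ 1) (hf0 : ∑ u ∈ range (2 ^ n), f u = 0)
    {t : ℝ} (ht0 : 0 ≤ t) (ht1 : t ≤ 1) :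
    ∑ j ∈ range (2 ^ k),
        Real.exp (t * ∑ q ∈ range ((k - r) / n), f (j / 2 ^ (n * q + r) % 2 ^ n)) ≤
      2 ^ k * Real.exp (t ^ 2 * (k / n)) := by
  set Q := (k - r) / n
  set s := (k - r) % n
  have hks : k = r + (n * Q + s) := by
    have : n * Q + s = k - r := Nat.div_add_mod (k - r) n
    omega
  have h2k : 2 ^ k = 2 ^ r * ((2 ^ n) ^ Q * 2 ^ s) := by
    conv_lhs => rw [hks]
    rw [pow_add, pow_add, pow_mul]
  have h1 := sum_range_mul_mod_mul_div (2 ^ r) ((2 ^ n) ^ Q * 2 ^ s) (fun _ => 1)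
    fun j => ∏ q ∈ range Q, Real.exp (t * f (j / (2 ^ n) ^ q % 2 ^ n))
  have h2 := sum_range_prod_digits (2 ^ n) Q (2 ^ s) fun u => Real.exp (t * f u)
  rw [h2, ← h2k] at h1
  have h3 := sum_exp_mul_le (range (2 ^ n)) (fun u hu => hf u (mem_range.1 hu)) hf0 ht0 ht1
  have hQk : (Q : ℝ) ≤ k / n := by
    rw [le_div_iff₀ (by positivity)]
    norm_cast
    rw [mul_comm]; omega
  calc _ = 2 ^ r * ((∑ u ∈ range (2 ^ n), Real.exp (t * f u)) ^ Q * 2 ^ s) := by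
        simp only [one_mul, sum_const, card_range, nsmul_eq_mul, mul_one] at h1
        push_cast at h1
        rw [← h1]
        refine sum_congr rfl fun j _ => ?_
        rw [mul_sum, Real.exp_sum]
        refine prod_congr rfl fun q _ => ?_
        rw [Nat.div_div_eq_div_mul, ← pow_mul, ← pow_add, add_comm r]
    _ ≤ 2 ^ r * ((2 ^ n * Real.exp (t ^ 2)) ^ Q * 2 ^ s) := by
        rw [card_range, Nat.cast_pow, Nat.cast_ofNat] at h3
        have h4 := pow_le_pow_left₀ (sum_nonneg fun u _ => (Real.exp_pos (t * f u)).le) h3 Q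
        exact mul_le_mul_of_nonneg_left (mul_le_mul_of_nonneg_right h4 (by positivity))
          (by positivity)
    _ = 2 ^ k * Real.exp (t ^ 2 * Q) := by
        have : (2 : ℝ) ^ k = 2 ^ r * ((2 ^ n) ^ Q * 2 ^ s) := by exact_mod_cast h2k
        rw [this, mul_pow, ← Real.exp_nat_mul, mul_comm (Q : ℝ)]; ring
    _ ≤ _ := by gcongr

open Finset in
theorem sum_range_eq_sum_residues {n k : ℕ} (hn : 1 ≤ n) (hk : n ≤ k) (F : ℕ → ℝ) :
    ∑ l ∈ range (k + 1 - n), F l = ∑ r ∈ range n, ∑ q ∈ range ((k - r) / n), F (n * q + r) := by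
  rw [← sum_fiberwise_of_maps_to (s := range (k + 1 - n)) (t := range n) (g := fun l => l % n)
    (fun l _ => mem_range.2 (Nat.mod_lt _ hn))]
  refine sum_congr rfl fun r hr => ?_
  have hr := mem_range.1 hr
  have hiff (q : ℕ) : q < (k - r) / n ↔ n * q + r < k + 1 - n := by
    rw [Nat.lt_iff_add_one_le, Nat.le_div_iff_mul_le hn, add_mul, one_mul, mul_comm]
    omega
  refine sum_nbij' (fun l => l / n) (fun q => n * q + r) ?_ ?_ ?_ ?_ ?_
  · intro l hl
    simp only [mem_filter, mem_range] at hl ⊢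
    rw [hiff, ← hl.2, Nat.div_add_mod]
    exact hl.1
  · intro q hq
    simp only [mem_filter, mem_range] at hq ⊢
    exact ⟨(hiff q).1 hq, by rw [Nat.mul_add_mod, Nat.mod_eq_of_lt hr]⟩
  · intro l hl
    simp only [mem_filter, mem_range] at hl
    simp only [← hl.2, Nat.div_add_mod]
  · intro q _
    simp only [Nat.mul_add_div hn, Nat.div_eq_of_lt hr, add_zero]
  · intro l hl
    simp only [mem_filter, mem_range] at hl
    simp only [← hl.2, Nat.div_add_mod]

open Finset in
theorem card_lt_sum_digits_le {n k : ℕ} (hn : 1 ≤ n) (hk : n ≤ k)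
    {f : ℕ → ℝ} (hf : ∀ u < 2 ^ n, |f u| ≤ 1) (hf0 : ∑ u ∈ range (2 ^ n), f u = 0)
    {t : ℝ} (ht0 : 0 ≤ t) (ht1 : t ≤ 1) :
    ((range (2 ^ k)).filter fun j =>
        2 * t * k < ∑ l ∈ range (k + 1 - n), f (j / 2 ^ l % 2 ^ n)).card ≤
      n * (2 ^ k * Real.exp (-(t ^ 2 / n * k))) := by
  have hn0 : (0 : ℝ) < n := by exact_mod_cast hn
  let S (r j : ℕ) : ℝ := ∑ q ∈ range ((k - r) / n), f (j / 2 ^ (n * q + r) % 2 ^ n)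
  have hsub : ((range (2 ^ k)).filter fun j =>
        2 * t * k < ∑ l ∈ range (k + 1 - n), f (j / 2 ^ l % 2 ^ n)) ⊆
      (range n).biUnion fun r => (range (2 ^ k)).filter fun j => 2 * t * k / n ≤ S r j := by
    intro j hj
    rw [mem_filter, sum_range_eq_sum_residues hn hk fun l => f (j / 2 ^ l % 2 ^ n)] at hj
    simp only [mem_biUnion, mem_filter]
    by_contra! hcon
    have : ∑ r ∈ range n, S r j ≤ ∑ _r ∈ range n, 2 * t * k / n :=
      sum_le_sum fun r hr => (hcon r hr hj.1).le
    rw [sum_const, card_range, nsmul_eq_mul, mul_div_cancel₀ _ hn0.ne'] at this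
    exact absurd hj.2 (not_lt.2 this)
  have hr : ∀ r ∈ range n, (((range (2 ^ k)).filter fun j => 2 * t * k / n ≤ S r j).card : ℝ) ≤
      2 ^ k * Real.exp (-(t ^ 2 / n * k)) := by
    intro r hr
    have h1 := sum_range_exp_sum_digits_le hn (mem_range.1 hr) hk hf hf0 ht0 ht1
    have h2 : (((range (2 ^ k)).filter fun j => 2 * t * k / n ≤ S r j).card : ℝ) *
        Real.exp (t * (2 * t * k / n)) ≤ ∑ j ∈ range (2 ^ k), Real.exp (t * S r j) := by
      rw [← nsmul_eq_mul]
      refine (card_nsmul_le_sum _ (fun j => Real.exp (t * S r j)) _ fun j hj => ?_).trans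
        (sum_le_sum_of_subset_of_nonneg (filter_subset _ _) fun _ _ _ => (Real.exp_pos _).le)
      have := (mem_filter.1 hj).2
      gcongr
    have h3 := h2.trans h1
    rw [← le_div_iff₀ (Real.exp_pos _), mul_div_assoc (2 ^ k), ← Real.exp_sub] at h3
    refine h3.trans_eq ?_
    congr 2
    ring
  calc _ ≤ (((range n).biUnion fun r =>
        (range (2 ^ k)).filter fun j => 2 * t * k / n ≤ S r j).card : ℝ) := by
        exact_mod_cast card_le_card hsub
    _ ≤ ∑ r ∈ range n, (((range (2 ^ k)).filter fun j => 2 * t * k / n ≤ S r j).card : ℝ) := by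
        exact_mod_cast card_biUnion_le
    _ ≤ ∑ _r ∈ range n, 2 ^ k * Real.exp (-(t ^ 2 / n * k)) := sum_le_sum hr
    _ = _ := by simp

open MeasureTheory Filter Topology ENNReal in
theorem hausdorffMeasure_setOf_frequently_mem_eq_zero {X : Type*} [EMetricSpace X]
    [MeasurableSpace X] [BorelSpace X] {d : ℝ} (hd : 0 ≤ d) (J : ℕ → Finset ℕ)
    (I : ℕ → ℕ → Set X) {r : ℕ → ℝ≥0∞} (hr : Antitone r) (hr0 : Tendsto r atTop (𝓝 0))
    (hI : ∀ k j, Metric.ediam (I k j) ≤ r k)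
    (hsum : ∑' k, ((J k).card : ℝ≥0∞) * r k ^ d ≠ ∞) :
    μH[d] {x | ∃ᶠ k in atTop, ∃ j ∈ J k, x ∈ I k j} = 0 := by
  have key := Measure.hausdorffMeasure_le_liminf_tsum (β := ℕ)
    (ι := fun K => Σ k : ℕ, J (k + K)) d {x | ∃ᶠ k in atTop, ∃ j ∈ J k, x ∈ I k j} r hr0
    (fun K p => I (p.1 + K) p.2)
    (Eventually.of_forall fun K p => (hI _ _).trans (hr (Nat.le_add_left _ _)))
    (Eventually.of_forall fun K x hx => by
      obtain ⟨k, hk, j, hj, hx⟩ := (frequently_atTop.1 hx) K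
      obtain ⟨m, rfl⟩ := Nat.exists_eq_add_of_le' hk
      exact Set.mem_iUnion.2 ⟨⟨m, j, hj⟩, hx⟩)
  refine le_antisymm (key.trans ?_) zero_le
  have htail := ENNReal.tendsto_sum_nat_add _ hsum
  rw [← htail.liminf_eq]
  refine liminf_le_liminf (Eventually.of_forall fun K => ?_)
  rw [ENNReal.tsum_sigma']
  refine ENNReal.tsum_le_tsum fun k => ?_
  calc _ ≤ ∑' _j : J (k + K), r (k + K) ^ d :=
        ENNReal.tsum_le_tsum fun j => ENNReal.rpow_le_rpow (hI _ _) hd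
    _ = _ := by simp [tsum_fintype]

theorem floor_two_pow_mul_eq_div (x : ℝ) (k l : ℕ) :
    ⌊(2 : ℝ) ^ k * x⌋₊ = ⌊(2 : ℝ) ^ (k + l) * x⌋₊ / 2 ^ l := by
  rw [← Nat.floor_div_natCast]
  congr 1
  push_cast
  rw [pow_add, mul_right_comm, mul_div_cancel_right₀ _ (by positivity)]

theorem binDigit_eq_testBit {x : ℝ} (hx : 0 ≤ x) {i k : ℕ} (hik : i < k) :
    binDigit i x = ⌊(2 : ℝ) ^ k * x⌋₊.testBit (k - 1 - i) := by
  have h := floor_two_pow_mul_eq_div x (i + 1) (k - 1 - i)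
  rw [show i + 1 + (k - 1 - i) = k by omega] at h
  rw [binDigit, Nat.testBit_eq_decide_div_mod_eq, ← h,
    ← Int.natCast_floor_eq_floor (by positivity)]
  congr 1
  norm_cast

open Finset in
theorem occCount_binDigit {n k : ℕ} (hk : n ≤ k) (w : Fin n → Bool) {x : ℝ} (hx : 0 ≤ x) :
    (occCount k n (fun i : Fin k => binDigit (i : ℕ) x) w : ℝ) =
      ∑ l ∈ range (k + 1 - n),
        if ⌊(2 : ℝ) ^ k * x⌋₊ / 2 ^ l % 2 ^ n = Nat.ofBits (fun b => w b.rev) then 1 else 0 := by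
  set j := ⌊(2 : ℝ) ^ k * x⌋₊
  have hiff {i : ℕ} (hi : i + n ≤ k) :
      (∀ (m : Fin n) (_ : i + (m : ℕ) < k), binDigit (i + m) x = w m) ↔
        j / 2 ^ (k - n - i) % 2 ^ n = Nat.ofBits (fun b => w b.rev) := by
    have hbit {b : ℕ} (hb : b < n) : j.testBit (k - n - i + b) = binDigit (i + (n - 1 - b)) x := by
      rw [binDigit_eq_testBit hx (show i + (n - 1 - b) < k by omega)]
      congr 1
      omega
    constructor
    · intro h
      refine Nat.eq_of_testBit_eq fun b => ?_
      rw [Nat.testBit_mod_two_pow, Nat.testBit_div_two_pow, Nat.testBit_ofBits]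
      by_cases hb : b < n
      · have := h ⟨n - 1 - b, by omega⟩ (by simp only; omega)
        simp only [hb, decide_true, Bool.true_and, dite_true]
        rw [add_comm, hbit hb, this]
        congr 1
        ext
        simp only [Fin.val_rev]
        omega
      · simp [hb]
    · intro h m hm
      have hb : n - 1 - (m : ℕ) < n := by omega
      have h2 := congrArg (fun a => a.testBit (n - 1 - m)) h
      simp only [Nat.testBit_mod_two_pow, Nat.testBit_div_two_pow, Nat.testBit_ofBits, hb,
        decide_true, Bool.true_and, dite_true] at h2
      rw [add_comm, hbit hb, show n - 1 - (n - 1 - (m : ℕ)) = m by omega] at h2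
      rw [h2]
      congr 1
      ext
      simp only [Fin.val_rev]
      omega
  rw [← sum_range_reflect, sum_boole, occCount]
  norm_cast
  refine Nat.subtype_card _ fun i => ?_
  rw [mem_filter, mem_range]
  constructor
  · rintro ⟨hi, h⟩
    refine ⟨by omega, (hiff (by omega)).2 ?_⟩
    rwa [show k - n - i = k + 1 - n - 1 - i by omega]
  · rintro ⟨hi, h⟩
    refine ⟨by omega, ?_⟩
    rw [show k + 1 - n - 1 - i = k - n - i by omega]
    exact (hiff hi).1 h

open Finset in
/-- The numbers `j < 2 ^ k` whose `k`-digit binary expansion contains the length-`n` word with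
value `W` with a frequency exceeding `2⁻ⁿ` by more than `2t` (`σ = 1`), or falling short of it
by that much (`σ = -1`). -/
noncomputable def deviantSet (n W : ℕ) (t σ : ℝ) (k : ℕ) : Finset ℕ :=
  (range (2 ^ k)).filter fun j => 2 * t * k < ∑ l ∈ range (k + 1 - n),
    σ * ((if j / 2 ^ l % 2 ^ n = W then 1 else 0) - (1 / 2) ^ n)

open Finset in
theorem card_deviantSet_le {n k W : ℕ} (hn : 1 ≤ n) (hk : n ≤ k) (hW : W < 2 ^ n) {t σ : ℝ}
    (hσ : |σ| = 1) (ht0 : 0 ≤ t) (ht1 : t ≤ 1) :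
    ((deviantSet n W t σ k).card : ℝ) ≤ n * (2 ^ k * Real.exp (-(t ^ 2 / n * k))) := by
  refine card_lt_sum_digits_le hn hk
    (f := fun u => σ * ((if u = W then 1 else 0) - (1 / 2) ^ n)) ?_ ?_ ht0 ht1
  · intro u _
    have h0 : (0 : ℝ) < (1 / 2) ^ n := by positivity
    have h1 : (1 / 2 : ℝ) ^ n ≤ 1 := pow_le_one₀ (by norm_num) (by norm_num)
    rw [abs_mul, hσ, one_mul, abs_le]
    split_ifs <;> constructor <;> linarith
  · rw [← mul_sum, sum_sub_distrib, sum_ite_eq' (range (2 ^ n)) W, if_pos (mem_range.2 hW),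
      sum_const, card_range, nsmul_eq_mul, Nat.cast_pow, Nat.cast_ofNat, ← mul_pow]
    norm_num

theorem floor_mem_deviantSet {n k : ℕ} (hn : 1 ≤ n) {w : Fin n → Bool} {x κ t : ℝ}
    (hx : x ∈ Set.Ico (0 : ℝ) 1) (ht : 4 * t ≤ κ) (hk : n ≤ k) (hnk : 2 * n ≤ κ * k)
    (hfreq : freq n k w x ∉ Set.Icc ((1 / 2 : ℝ) ^ n - κ) ((1 / 2 : ℝ) ^ n + κ)) :
    ⌊(2 : ℝ) ^ k * x⌋₊ ∈ deviantSet n (Nat.ofBits fun b => w b.rev) t 1 k ∪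
      deviantSet n (Nat.ofBits fun b => w b.rev) t (-1) k := by
  have hk0 : (0 : ℝ) < k := by exact_mod_cast hn.trans hk
  have hn1 : (1 : ℝ) ≤ n := by exact_mod_cast hn
  have hlt : ⌊(2 : ℝ) ^ k * x⌋₊ < 2 ^ k := by
    rw [Nat.floor_lt (mul_nonneg (by positivity) hx.1)]
    push_cast
    exact mul_lt_of_lt_one_right (by positivity) hx.2
  have hp0 : (0 : ℝ) < (1 / 2) ^ n := by positivity
  have hp1 : (1 / 2 : ℝ) ^ n ≤ 1 := pow_le_one₀ (by norm_num) (by norm_num)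
  have hsub : ((k + 1 - n : ℕ) : ℝ) = k + 1 - n := by
    rw [Nat.cast_sub (by omega)]
    push_cast
    ring
  have htk : 4 * t * k ≤ κ * k := by gcongr
  have hpn : (1 / 2 : ℝ) ^ n * n ≤ 1 * n := by gcongr
  have hpn' : (1 / 2 : ℝ) ^ n * 1 ≤ (1 / 2 : ℝ) ^ n * n := by gcongr
  simp only [deviantSet, Finset.mem_union, Finset.mem_filter, Finset.mem_range, hlt, true_and,
    ← Finset.mul_sum, Finset.sum_sub_distrib, ← occCount_binDigit hk w hx.1, Finset.sum_const,
    Finset.card_range, nsmul_eq_mul, hsub]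
  rw [Set.mem_Icc, not_and_or, not_le, not_le, freq, div_lt_iff₀ hk0, lt_div_iff₀ hk0] at hfreq
  rcases hfreq with h | h
  · right
    nlinarith
  · left
    nlinarith

open Filter in
theorem IsAtypicalPt.frequently {n : ℕ} {κ : ℝ} {w : Fin n → Bool} {x : ℝ}
    (h : IsAtypicalPt n κ w x) :
    ∃ᶠ k in atTop, freq n k w x ∉ Set.Icc ((1 / 2 : ℝ) ^ n - κ) ((1 / 2 : ℝ) ^ n + κ) := by
  obtain ⟨c, hc, hcl⟩ := h
  exact hcl.frequently (isClosed_Icc.isOpen_compl.mem_nhds hc)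

open MeasureTheory Filter Topology ENNReal in
/-- The set `A_{κ,w} ⊆ [0,1)` of `κ,w`-atypical points has Hausdorff dimension at most
`1 - ε` for some `ε = ε(κ, w) > 0`. -/
theorem dimH_atypical_le (n : ℕ) (hn : 1 ≤ n) (w : Fin n → Bool) (κ : ℝ) (hκ : 0 < κ) :
    ∃ ε : ℝ, 0 < ε ∧
      dimH {x : ℝ | x ∈ Set.Ico (0 : ℝ) 1 ∧ IsAtypicalPt n κ w x} ≤ ENNReal.ofReal (1 - ε) := by
  have hn0 : (0 : ℝ) < n := by exact_mod_cast hn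
  set t := min 1 (κ / 4)
  have ht0 : 0 < t := lt_min one_pos (by positivity)
  have ht1 : t ≤ 1 := min_le_left _ _
  have htκ : 4 * t ≤ κ := by linarith [min_le_right 1 (κ / 4)]
  set η := t ^ 2 / n
  have hη : 0 < η := by positivity
  set W := Nat.ofBits fun b => w b.rev
  have hW : W < 2 ^ n := Nat.ofBits_lt_two_pow _
  set ε := min 1 (η / 2)
  have hε0 : 0 < ε := lt_min one_pos (by positivity)
  have hε1 : ε ≤ 1 := min_le_left _ _
  have hεη : ε ≤ η / 2 := min_le_right _ _
  refine ⟨ε, hε0, ?_⟩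
  have hd : 0 ≤ 1 - ε := by linarith
  let J (k : ℕ) : Finset ℕ := if n ≤ k then deviantSet n W t 1 k ∪ deviantSet n W t (-1) k else ∅
  have hJ (k : ℕ) : ((J k).card : ℝ) ≤ 2 * n * (2 ^ k * Real.exp (-(η * k))) := by
    by_cases hk : n ≤ k
    · have h1 := card_deviantSet_le hn hk hW (σ := 1) (by simp) ht0.le ht1
      have h2 := card_deviantSet_le hn hk hW (σ := -1) (by simp) ht0.le ht1
      have h3 : ((J k).card : ℝ) ≤ (deviantSet n W t 1 k).card + (deviantSet n W t (-1) k).card := by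
        simp only [J, if_pos hk]
        exact_mod_cast Finset.card_union_le _ _
      linarith
    · simp only [J, if_neg hk, Finset.card_empty, Nat.cast_zero]
      positivity
  let r (k : ℕ) : ℝ≥0∞ := ENNReal.ofReal ((1 / 2) ^ k)
  have hr : Antitone r := fun a b hab =>
    ENNReal.ofReal_le_ofReal (pow_le_pow_of_le_one (by norm_num) (by norm_num) hab)
  have hr0 : Tendsto r atTop (𝓝 0) := by
    rw [← ENNReal.ofReal_zero]
    exact ENNReal.tendsto_ofReal
      (tendsto_pow_atTop_nhds_zero_of_lt_one (by norm_num) (by norm_num))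
  have hterm (k : ℕ) : ((J k).card : ℝ≥0∞) * r k ^ (1 - ε) ≤
      ENNReal.ofReal (2 * n * Real.exp (-(η / 2)) ^ k) := by
    simp only [r]
    rw [ENNReal.ofReal_rpow_of_nonneg (by positivity) hd, ← ENNReal.ofReal_natCast,
      ← ENNReal.ofReal_mul (by positivity)]
    refine ENNReal.ofReal_le_ofReal ?_
    have hlog : Real.log 2 ≤ 1 := by linarith [Real.log_two_lt_d9]
    have hlog0 : 0 ≤ Real.log 2 := Real.log_nonneg (by norm_num)
    have h2 : (2 : ℝ) ^ k = Real.exp (k * Real.log 2) := by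
      rw [Real.exp_nat_mul, Real.exp_log two_pos]
    have hhalf : ((1 / 2 : ℝ) ^ k) ^ (1 - ε) = Real.exp (-(k * Real.log 2) * (1 - ε)) := by
      rw [one_div, inv_pow, h2, ← Real.exp_neg, Real.exp_mul]
    calc _ ≤ 2 * n * (2 ^ k * Real.exp (-(η * k))) * ((1 / 2 : ℝ) ^ k) ^ (1 - ε) := by
          gcongr
          exact hJ k
      _ = 2 * n * Real.exp (k * (Real.log 2 * ε - η)) := by
          rw [hhalf, h2, mul_assoc, ← Real.exp_add, ← Real.exp_add]
          ring_nf
      _ ≤ 2 * n * Real.exp (k * (-(η / 2))) := by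
          gcongr
          nlinarith
      _ = _ := by rw [Real.exp_nat_mul]
  have hsum : ∑' k, ((J k).card : ℝ≥0∞) * r k ^ (1 - ε) ≠ ∞ := by
    refine ne_top_of_le_ne_top ?_ (ENNReal.tsum_le_tsum hterm)
    refine ((summable_geometric_of_lt_one (Real.exp_pos _).le ?_).mul_left _).tsum_ofReal_ne_top
    exact Real.exp_lt_one_iff.2 (by linarith)
  have hzero := hausdorffMeasure_setOf_frequently_mem_eq_zero hd J
    (fun k j => Set.Icc ((j : ℝ) / 2 ^ k) ((j + 1) / 2 ^ k)) hr hr0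
    (fun k j => by
      rw [Real.ediam_Icc]
      refine ENNReal.ofReal_le_ofReal (le_of_eq ?_)
      rw [one_div, inv_pow]
      ring) hsum
  have hsubset : {x : ℝ | x ∈ Set.Ico (0 : ℝ) 1 ∧ IsAtypicalPt n κ w x} ⊆
      {x | ∃ᶠ k in atTop, ∃ j ∈ J k, x ∈ Set.Icc ((j : ℝ) / 2 ^ k) ((j + 1) / 2 ^ k)} := by
    rintro x ⟨hx, hat⟩
    have hlarge : ∀ᶠ k : ℕ in atTop, 2 * (n : ℝ) ≤ κ * k :=
      (tendsto_natCast_atTop_atTop.const_mul_atTop hκ).eventually_ge_atTop _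
    refine (hat.frequently.and_eventually (hlarge.and (eventually_ge_atTop n))).mono ?_
    rintro k ⟨hfreq, hnk, hk⟩
    refine ⟨⌊(2 : ℝ) ^ k * x⌋₊, ?_, ?_, ?_⟩
    · simp only [J, if_pos hk]
      exact floor_mem_deviantSet hn hx htκ hk hnk hfreq
    · rw [div_le_iff₀' (by positivity)]
      exact Nat.floor_le (mul_nonneg (by positivity) hx.1)
    · rw [le_div_iff₀' (by positivity)]
      exact (Nat.lt_floor_add_one _).le
  have hmeas : μH[((1 - ε).toNNReal : ℝ)]
      {x : ℝ | x ∈ Set.Ico (0 : ℝ) 1 ∧ IsAtypicalPt n κ w x} = 0 := by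
    rw [Real.coe_toNNReal _ hd]
    exact measure_mono_null hsubset hzero
  exact dimH_le_of_hausdorffMeasure_ne_top (by rw [hmeas]; exact ENNReal.zero_ne_top)
end

section
/- (Weak Ergodic Theorem for the doubling map.) Let ζ be the doubling map of the circle S¹ = ℝ/ℤ, ζ(y) = 2y. Let φ : S¹ → ℝ be continuous and δ > 0. Define the partial time averages φ_n(y) = (1/n) Σ_{i=0}^{n−1} φ(ζ^i(y)) and the space average I = ∫_{S¹} φ (with respect to normalized Lebesgue/Haar measure). Then the set K_{φ,δ} = { y ∈ S¹ : the sequence (φ_n(y))_{n≥1} has a limit (accumulation) point outside the interval [I − δ, I + δ] } has Hausdorff dimension strictly smaller than 1. -/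
open MeasureTheory Filter

section

open Set Topology

/-- The transfer operator of the doubling map, acting on functions of a real variable. -/
noncomputable def halfTransfer (F : ℝ → ℝ) (x : ℝ) : ℝ := (F (x / 2) + F ((x + 1) / 2)) / 2

/-- The Birkhoff sum of `F` along the orbit of `x` under doubling. -/
noncomputable def doublingSum (F : ℝ → ℝ) (n : ℕ) (x : ℝ) : ℝ :=
  ∑ i ∈ Finset.range n, F (2 ^ i * x)

lemma halfTransfer_periodic {F : ℝ → ℝ} (hF : Function.Periodic F 1) :
    Function.Periodic (halfTransfer F) 1 := by
  intro x
  have h : F ((x + 1 + 1) / 2) = F (x / 2) := by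
    rw [← hF (x / 2)]; congr 1; ring
  simp only [halfTransfer, h]; ring

lemma halfTransfer_continuous {F : ℝ → ℝ} (hF : Continuous F) :
    Continuous (halfTransfer F) := by
  unfold halfTransfer; fun_prop

lemma halfTransfer_bounded {F : ℝ → ℝ} {M : ℝ} (hF : ∀ x, |F x| ≤ M) (x : ℝ) :
    |halfTransfer F x| ≤ M := by
  have h1 := abs_le.1 (hF (x / 2))
  have h2 := abs_le.1 (hF ((x + 1) / 2))
  unfold halfTransfer
  rw [abs_le]; constructor <;> linarith [h1.1, h1.2, h2.1, h2.2]

lemma integral_halfTransfer {F : ℝ → ℝ} (hF : Continuous F) :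
    ∫ x in (0 : ℝ)..1, halfTransfer F x = ∫ x in (0 : ℝ)..1, F x := by
  have h1 : ∫ x in (0 : ℝ)..1, F (x / 2) = 2 * ∫ x in (0 : ℝ)..(1 / 2), F x := by
    rw [intervalIntegral.integral_comp_div F two_ne_zero]; simp
  have h2 : ∫ x in (0 : ℝ)..1, F ((x + 1) / 2) = 2 * ∫ x in (1 / 2 : ℝ)..1, F x := by
    have := intervalIntegral.integral_comp_add_div (a := 0) (b := 1) F (two_ne_zero (α := ℝ)) (1 / 2)
    rw [show (1 / 2 + 1 / 2 : ℝ) = 1 by norm_num] at this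
    simp only [zero_div, add_zero, smul_eq_mul] at this
    rw [← this]
    congr 1; ext x; congr 1; ring
  have hi : ∀ a b, IntervalIntegrable F volume a b := fun a b => hF.intervalIntegrable a b
  unfold halfTransfer
  rw [intervalIntegral.integral_div, intervalIntegral.integral_add, h1, h2,
    ← intervalIntegral.integral_add_adjacent_intervals (hi 0 (1 / 2)) (hi (1 / 2) 1)]
  · ring
  · exact (by fun_prop : Continuous fun x : ℝ => F (x / 2)).intervalIntegrable _ _
  · exact (by fun_prop : Continuous fun x : ℝ => F ((x + 1) / 2)).intervalIntegrable _ _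

lemma halfTransfer_iterate_props {F : ℝ → ℝ} (hc : Continuous F) (hp : Function.Periodic F 1)
    (n : ℕ) : Continuous (halfTransfer^[n] F) ∧ Function.Periodic (halfTransfer^[n] F) 1 ∧
      ∫ x in (0 : ℝ)..1, (halfTransfer^[n] F) x = ∫ x in (0 : ℝ)..1, F x := by
  induction n with
  | zero => exact ⟨hc, hp, rfl⟩
  | succ n ih =>
    rw [Function.iterate_succ_apply']
    exact ⟨halfTransfer_continuous ih.1, halfTransfer_periodic ih.2.1,
      (integral_halfTransfer ih.1).trans ih.2.2⟩

lemma halfTransfer_iterate_bounded {F : ℝ → ℝ} {M : ℝ} (hF : ∀ x, |F x| ≤ M) (n : ℕ) (x : ℝ) :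
    |(halfTransfer^[n] F) x| ≤ M := by
  induction n generalizing x with
  | zero => exact hF x
  | succ n ih =>
    rw [Function.iterate_succ_apply']
    exact halfTransfer_bounded ih x

lemma halfTransfer_iterate_osc {F : ℝ → ℝ} {d ε : ℝ}
    (hF : ∀ x y, |x - y| < d → |F x - F y| ≤ ε) (n : ℕ) {x y : ℝ} (h : |x - y| < 2 ^ n * d) :
    |(halfTransfer^[n] F) x - (halfTransfer^[n] F) y| ≤ ε := by
  induction n generalizing x y with
  | zero => exact hF x y (by simpa using h)
  | succ n ih =>
    rw [Function.iterate_succ_apply']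
    have hh : |x - y| / 2 < 2 ^ n * d := by rw [pow_succ] at h; linarith
    have e1 : |x / 2 - y / 2| = |x - y| / 2 := by
      rw [← sub_div, abs_div, abs_two]
    have e2 : |(x + 1) / 2 - (y + 1) / 2| = |x - y| / 2 := by
      rw [← sub_div, abs_div, abs_two]; congr 2; ring
    have h1 := abs_le.1 (ih (x := x / 2) (y := y / 2) (by rwa [e1]))
    have h2 := abs_le.1 (ih (x := (x + 1) / 2) (y := (y + 1) / 2) (by rwa [e2]))
    rw [halfTransfer, halfTransfer, abs_le]
    constructor <;> linarith [h1.1, h1.2, h2.1, h2.2]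

/-- The iterates of the transfer operator converge uniformly to the space average. -/
lemma exists_halfTransfer_iterate_le {F : ℝ → ℝ} (hc : Continuous F)
    (hp : Function.Periodic F 1) (hu : UniformContinuous F) {ε : ℝ} (hε : 0 < ε) :
    ∃ n, ∀ x, (halfTransfer^[n + 1] F) x ≤ (∫ y in (0 : ℝ)..1, F y) + ε := by
  obtain ⟨d, hd, hF⟩ := Metric.uniformContinuous_iff.1 hu ε hε
  simp only [Real.dist_eq] at hF
  obtain ⟨n, hn⟩ := pow_unbounded_of_one_lt (1 / d) (one_lt_two (α := ℝ))
  have hn' : 1 < 2 ^ (n + 1) * d := by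
    rw [div_lt_iff₀ hd] at hn
    rw [pow_succ]; linarith
  refine ⟨n, fun x => ?_⟩
  obtain ⟨gc, gp, gi⟩ := halfTransfer_iterate_props hc hp (n + 1)
  have key : ∀ y ∈ Icc x (x + 1),
      (halfTransfer^[n + 1] F) x - ε ≤ (halfTransfer^[n + 1] F) y := by
    intro y hy
    have hxy : |x - y| < 2 ^ (n + 1) * d := by
      refine lt_of_le_of_lt ?_ hn'
      rw [abs_le]; constructor <;> linarith [hy.1, hy.2]
    have := abs_le.1 (halfTransfer_iterate_osc (fun a b hab => (hF hab).le) (n + 1) hxy)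
    linarith [this.2]
  have := intervalIntegral.integral_mono_on (by linarith) (by simp)
    (gc.intervalIntegrable (μ := volume) x (x + 1)) key
  rw [gp.intervalIntegral_add_eq x 0, zero_add, gi] at this
  simp only [intervalIntegral.integral_const, add_sub_cancel_left, one_smul] at this
  linarith

/-- Up to a bounded coboundary, `F` may be replaced by a function whose image under the transfer
operator is an iterate of the transfer operator on `F`. -/
lemma exists_coboundary {F : ℝ → ℝ} (hc : Continuous F) (hp : Function.Periodic F 1) {M : ℝ}
    (hM : ∀ x, |F x| ≤ M) (n : ℕ) :
    ∃ u : ℝ → ℝ, Function.Periodic u 1 ∧ (∃ B, ∀ x, |u x| ≤ B) ∧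
      ∀ x, halfTransfer (fun y => F y - u y + u (2 * y)) x = (halfTransfer^[n + 1] F) x := by
  induction n with
  | zero => exact ⟨0, fun _ => rfl, ⟨0, by simp⟩, by simp [halfTransfer]⟩
  | succ n ih =>
    obtain ⟨u, up, ⟨B, hB⟩, hu⟩ := ih
    have vp := (halfTransfer_iterate_props hc hp (n + 1)).2.1
    have vb := halfTransfer_iterate_bounded hM (n + 1)
    rw [Function.iterate_succ_apply']
    set v := halfTransfer^[n + 1] F
    refine ⟨fun x => u x - v x, fun x => by simp [up x, vp x], ⟨B + M, fun x => ?_⟩, fun x => ?_⟩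
    · exact (abs_sub _ _).trans (add_le_add (hB x) (vb x))
    · have h := hu x
      have e1 : 2 * (x / 2) = x := by ring
      have e2 : 2 * ((x + 1) / 2) = x + 1 := by ring
      simp only [halfTransfer, e1, e2, vp x, up x] at h ⊢
      linarith

/-- A bounded function with uniformly negative transfer has a small exponential transfer. -/
lemma exists_exp_transfer_le {f : ℝ → ℝ} {B η : ℝ} (hη : 0 < η) (hB : ∀ x, |f x| ≤ B)
    (hf : ∀ x, halfTransfer f x ≤ -η) :
    ∃ t ρ : ℝ, 0 < t ∧ 0 < ρ ∧ ρ < 1 ∧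
      ∀ x, Real.exp (t * f (x / 2)) + Real.exp (t * f ((x + 1) / 2)) ≤ 2 * ρ := by
  have hηB : η ≤ B := by
    have := abs_le.1 (halfTransfer_bounded hB 0)
    linarith [hf 0, this.1]
  have hB0 : 0 < B := hη.trans_le hηB
  have ht : 0 < η / (2 * B ^ 2) := by positivity
  set t := η / (2 * B ^ 2) with htdef
  have htB : t * B ≤ 1 / 2 := by
    rw [htdef, div_mul_eq_mul_div, div_le_iff₀ (by positivity)]; nlinarith
  have htB2 : t * B ^ 2 = η / 2 := by rw [htdef]; field_simp
  have hex : ∀ y, Real.exp (t * f y) ≤ 1 + t * f y + t * (η / 2) := by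
    intro y
    have h1 : |t * f y| ≤ t * B := by
      rw [abs_mul, abs_of_pos ht]; exact mul_le_mul_of_nonneg_left (hB y) ht.le
    have h2 := (abs_le.1 (Real.abs_exp_sub_one_sub_id_le (x := t * f y) (by linarith))).2
    have h3 : (t * f y) ^ 2 ≤ (t * B) ^ 2 := sq_le_sq' (by linarith [(abs_le.1 h1).1])
      (abs_le.1 h1).2
    have h4 : (t * B) ^ 2 = t * (η / 2) := by rw [← htB2]; ring
    linarith
  refine ⟨t, 1 - t * (η / 2), ht, ?_, by linarith [mul_pos ht hη], fun x => ?_⟩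
  · nlinarith
  · have h1 := hex (x / 2)
    have h2 := hex ((x + 1) / 2)
    have h3 := mul_le_mul_of_nonneg_left (hf x) ht.le
    unfold halfTransfer at h3
    linarith

lemma doublingSum_periodic {f : ℝ → ℝ} (hf : Function.Periodic f 1) (n : ℕ) :
    Function.Periodic (doublingSum f n) 1 := by
  intro x
  refine Finset.sum_congr rfl fun i _ => ?_
  have := hf.nat_mul (2 ^ i) (2 ^ i * x)
  rw [← this]; congr 1; push_cast; ring

lemma doublingSum_succ (f : ℝ → ℝ) (n : ℕ) (x : ℝ) :
    doublingSum f (n + 1) x = doublingSum f n (2 * x) + f x := by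
  simp only [doublingSum, Finset.sum_range_succ', pow_succ, pow_zero, one_mul, mul_assoc]

lemma doublingSum_coboundary (F u : ℝ → ℝ) (n : ℕ) (x : ℝ) :
    doublingSum (fun y => F y - u y + u (2 * y)) n x =
      doublingSum F n x - u x + u (2 ^ n * x) := by
  induction n with
  | zero => simp [doublingSum]
  | succ n ih =>
    have e : 2 * (2 ^ n * x) = 2 ^ (n + 1) * x := by ring
    simp only [doublingSum, Finset.sum_range_succ] at ih ⊢
    rw [ih, e]; ring

lemma sum_exp_doublingSum_le {f : ℝ → ℝ} (hp : Function.Periodic f 1) {t ρ : ℝ} (hρ : 0 < ρ)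
    (h : ∀ x, Real.exp (t * f (x / 2)) + Real.exp (t * f ((x + 1) / 2)) ≤ 2 * ρ) (n : ℕ)
    (x : ℝ) :
    ∑ j ∈ Finset.range (2 ^ n), Real.exp (t * doublingSum f n ((x + j) / 2 ^ n)) ≤
      (2 * ρ) ^ n := by
  induction n with
  | zero => simp [doublingSum]
  | succ n ih =>
    rw [show 2 ^ (n + 1) = 2 ^ n + 2 ^ n by ring, Finset.sum_range_add, ← Finset.sum_add_distrib,
      pow_succ (2 * ρ)]
    calc _ = ∑ j ∈ Finset.range (2 ^ n), Real.exp (t * doublingSum f n ((x + j) / 2 ^ n)) *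
          (Real.exp (t * f ((x + j) / 2 ^ n / 2)) +
            Real.exp (t * f (((x + j) / 2 ^ n + 1) / 2))) := by
          refine Finset.sum_congr rfl fun j _ => ?_
          have hpow : (2 : ℝ) ^ n ≠ 0 := by positivity
          have e1 : (x + j) / 2 ^ (n + 1) = (x + j) / 2 ^ n / 2 := by rw [pow_succ]; field_simp
          have e2 : (x + ((2 ^ n + j : ℕ) : ℝ)) / 2 ^ (n + 1) = ((x + j) / 2 ^ n + 1) / 2 := by
            push_cast; rw [pow_succ]; field_simp; ring
          rw [e1, e2, doublingSum_succ, doublingSum_succ, mul_div_cancel₀ _ two_ne_zero,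
            mul_div_cancel₀ _ two_ne_zero, doublingSum_periodic hp n, mul_add, mul_add,
            mul_add, Real.exp_add, Real.exp_add]
      _ ≤ ∑ j ∈ Finset.range (2 ^ n), Real.exp (t * doublingSum f n ((x + j) / 2 ^ n)) *
          (2 * ρ) := by
          gcongr; exact h _
      _ ≤ _ := by rw [← Finset.sum_mul]; gcongr

/-- Hausdorff dimension bound for a limsup of finite families of small sets. -/
lemma dimH_le_of_frequently_cover {X : Type*} [EMetricSpace X] {ι : ℕ → Type*}
    [∀ n, Fintype (ι n)] (T : ∀ n, ι n → Set X) (r : ℕ → ENNReal) (hr : Antitone r)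
    (hr0 : Tendsto r atTop (𝓝 0)) (hT : ∀ n i, Metric.ediam (T n i) ≤ r n)
    {s : NNReal} (hs : 0 < s) (hsum : ∑' n, ∑ i, Metric.ediam (T n i) ^ (s : ℝ) ≠ ⊤) {A : Set X}
    (hA : ∀ x ∈ A, ∃ᶠ n in atTop, ∃ i, x ∈ T n i) : dimH A ≤ s := by
  classical
  borelize X
  refine dimH_le_of_hausdorffMeasure_ne_top (ne_top_of_le_ne_top hsum ?_)
  let T' : ℕ → (Σ n, ι n) → Set X := fun m p => if m ≤ p.1 then T p.1 p.2 else ∅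
  have hs' : (0 : ℝ) < s := hs
  refine (Measure.hausdorffMeasure_le_liminf_tsum s A r hr0 T' (.of_forall fun m p => ?_)
    (.of_forall fun m x hx => ?_)).trans ?_
  · by_cases h : m ≤ p.1
    · simpa [T', h] using (hT p.1 p.2).trans (hr h)
    · simp [T', h]
  · obtain ⟨n, hn, i, hi⟩ := frequently_atTop.1 (hA x hx) m
    exact mem_iUnion.2 ⟨⟨n, i⟩, by simpa [T', hn] using hi⟩
  · refine (liminf_le_liminf (v := fun _ => ∑' n, ∑ i, Metric.ediam (T n i) ^ (s : ℝ))
      (.of_forall fun m => ?_)).trans (by simp)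
    rw [ENNReal.tsum_sigma']
    refine ENNReal.tsum_le_tsum fun n => ?_
    rw [tsum_fintype]
    refine Finset.sum_le_sum fun i _ => ?_
    by_cases h : m ≤ n
    · simp [T', h]
    · simp [T', h, hs']

lemma exists_exponent {ρ : ℝ} (hρ : ρ < 1) :
    ∃ s : ℝ, 0 < s ∧ s < 1 ∧ (2⁻¹ : ℝ) ^ s * (2 * ρ) < 1 := by
  have hc : Tendsto (fun s : ℝ => (2⁻¹ : ℝ) ^ s * (2 * ρ)) (𝓝[<] 1)
      (𝓝 ((2⁻¹ : ℝ) ^ (1 : ℝ) * (2 * ρ))) :=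
    ((Real.continuousAt_const_rpow (by norm_num)).mul continuousAt_const).mono_left
      nhdsWithin_le_nhds
  have h1 := hc.eventually_lt_const (u := 1) (by rw [Real.rpow_one]; linarith)
  obtain ⟨s, hs, hs'⟩ := (h1.and (Ioo_mem_nhdsLT (show (0 : ℝ) < 1 by norm_num))).exists
  exact ⟨s, hs'.1, hs'.2, hs⟩

lemma exists_near_grid {x : ℝ} (hx : x ∈ Ico (0 : ℝ) 1) {q : ℕ} (hq : 0 < q) (n : ℕ) :
    ∃ i < q, ∃ j < 2 ^ n, |x - ((i / q : ℝ) + (j : ℕ)) / 2 ^ n| ≤ (q : ℝ)⁻¹ / 2 ^ n := by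
  have hq' : (0 : ℝ) < q := by exact_mod_cast hq
  have hpow : (0 : ℝ) < 2 ^ n := by positivity
  have hy0 : 0 ≤ 2 ^ n * x := mul_nonneg hpow.le hx.1
  have hj1 := Nat.floor_le hy0
  have hj2 := Nat.lt_floor_add_one (2 ^ n * x)
  set j := ⌊2 ^ n * x⌋₊
  have hr0 : 0 ≤ q * (2 ^ n * x - j) := mul_nonneg hq'.le (by linarith)
  have hi1 := Nat.floor_le hr0
  have hi2 := Nat.lt_floor_add_one (q * (2 ^ n * x - j))
  set i := ⌊q * (2 ^ n * x - j)⌋₊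
  refine ⟨i, ?_, j, ?_, ?_⟩
  · have : (i : ℝ) < q := by nlinarith
    exact_mod_cast this
  · have : (j : ℝ) < (2 ^ n : ℕ) := by push_cast; nlinarith [hx.2]
    exact_mod_cast this
  · have e : x - ((i / q : ℝ) + j) / 2 ^ n = (q * (2 ^ n * x - j) - i) / q / 2 ^ n := by
      field_simp; ring
    rw [e, abs_div, abs_div, abs_of_pos hpow, abs_of_pos hq', inv_eq_one_div]
    gcongr
    rw [abs_le]; constructor <;> linarith

lemma abs_doublingSum_sub_le {F : ℝ → ℝ} {d ε : ℝ} (hF : ∀ x y, |x - y| < d → |F x - F y| ≤ ε)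
    {n : ℕ} {x y : ℝ} (h : 2 ^ n * |x - y| < d) :
    |doublingSum F n x - doublingSum F n y| ≤ n * ε := by
  unfold doublingSum
  rw [← Finset.sum_sub_distrib]
  refine (Finset.abs_sum_le_sum_abs _ _).trans ?_
  refine (Finset.sum_le_card_nsmul _ _ ε fun i hi => hF _ _ (lt_of_le_of_lt ?_ h)).trans (by simp)
  rw [← mul_sub, abs_mul, abs_of_pos (by positivity : (0 : ℝ) < 2 ^ i)]
  have := (Finset.mem_range.1 hi).le
  gcongr
  norm_num

/-- Large deviations: the points whose Birkhoff averages frequently exceed a level above the space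
average form a set of dimension less than one. -/
lemma dimH_frequently_lt_doublingSum {F : ℝ → ℝ} (hc : Continuous F) (hp : Function.Periodic F 1)
    (hu : UniformContinuous F) {M : ℝ} (hM : ∀ x, |F x| ≤ M) {a : ℝ}
    (ha : ∫ x in (0 : ℝ)..1, F x < a) :
    dimH {x ∈ Ico (0 : ℝ) 1 | ∃ᶠ n : ℕ in atTop, n * a < doublingSum F n x} < 1 := by
  set I := ∫ x in (0 : ℝ)..1, F x with hI
  obtain ⟨h, hh⟩ : ∃ h, h = (a - I) / 2 := ⟨_, rfl⟩
  have hpos : 0 < h := by linarith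
  let g : ℝ → ℝ := fun x => F x - (a - h)
  have gc : Continuous g := by fun_prop
  have gp : Function.Periodic g 1 := fun x => by simp [g, hp x]
  have gu : UniformContinuous g := hu.sub uniformContinuous_const
  have gM : ∀ x, |g x| ≤ M + |a - h| := fun x => (abs_sub _ _).trans (by gcongr; exact hM x)
  have gI : ∫ x in (0 : ℝ)..1, g x = -h := by
    rw [intervalIntegral.integral_sub (hc.intervalIntegrable _ _) (by simp), ← hI]
    simp; linarith
  obtain ⟨N, hN⟩ := exists_halfTransfer_iterate_le gc gp gu (half_pos hpos)
  obtain ⟨u, up, ⟨B, hB⟩, huN⟩ := exists_coboundary gc gp gM N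
  let f : ℝ → ℝ := fun y => g y - u y + u (2 * y)
  have fp : Function.Periodic f 1 := fun x => by
    have : u (2 * (x + 1)) = u (2 * x) := by
      rw [← up (2 * x), ← up (2 * x + 1)]; congr 1; ring
    simp [f, gp x, up x, this]
  have fB : ∀ x, |f x| ≤ (M + |a - h|) + B + B := fun x =>
    (abs_add_le _ _).trans (add_le_add ((abs_sub _ _).trans (add_le_add (gM x) (hB x))) (hB _))
  obtain ⟨t, ρ, ht, hρ0, hρ1, htρ⟩ := exists_exp_transfer_le (f := f) (half_pos hpos) fB
    (fun x => by rw [huN x]; linarith [hN x])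
  obtain ⟨s, hs0, hs1, hsρ⟩ := exists_exponent hρ1
  obtain ⟨d, hd, hgd⟩ := Metric.uniformContinuous_iff.1 gu h hpos
  simp only [Real.dist_eq] at hgd
  obtain ⟨q, hq⟩ := exists_nat_gt d⁻¹
  have hq0 : (0 : ℝ) < q := (inv_pos.2 hd).trans hq
  have hq0' : 0 < q := by exact_mod_cast hq0
  have hqd : (q : ℝ)⁻¹ < d := inv_lt_of_inv_lt₀ hd hq
  have hq1 : (q : ℝ)⁻¹ ≤ 1 := inv_le_one_of_one_le₀ (by exact_mod_cast hq0')
  let c : ∀ n : ℕ, Fin q × Fin (2 ^ n) → ℝ :=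
    fun n p => ((((p.1 : ℕ) : ℝ) / q) + ((p.2 : ℕ) : ℝ)) / 2 ^ n
  let T : ∀ n : ℕ, Fin q × Fin (2 ^ n) → Set ℝ :=
    fun n p => {x | x ∈ Metric.closedBall (c n p) ((2⁻¹ : ℝ) ^ n) ∧ 0 ≤ doublingSum g n (c n p)}
  let r : ℕ → ENNReal := fun n => ENNReal.ofReal (2 * (2⁻¹ : ℝ) ^ n)
  have hTr : ∀ n p, Metric.ediam (T n p) ≤ r n := fun n p => by
    refine Metric.ediam_le_of_forall_dist_le fun x hx y hy => ?_
    have h1 := Metric.mem_closedBall.1 hx.1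
    have h2 := Metric.mem_closedBall.1 hy.1
    linarith [dist_triangle_right x y (c n p)]
  have hterm : ∀ n p, Metric.ediam (T n p) ^ s ≤
      ENNReal.ofReal (2 ^ s * ((2⁻¹ : ℝ) ^ s) ^ n * Real.exp (t * (2 * B)) *
        Real.exp (t * doublingSum f n (c n p))) := fun n p => by
    by_cases hg : 0 ≤ doublingSum g n (c n p)
    · refine (ENNReal.rpow_le_rpow (hTr n p) hs0.le).trans ?_
      rw [ENNReal.ofReal_rpow_of_nonneg (by positivity) hs0.le]
      refine ENNReal.ofReal_le_ofReal ?_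
      rw [Real.mul_rpow (by norm_num) (by positivity), Real.rpow_pow_comm (by norm_num),
        mul_assoc, ← Real.exp_add]
      refine le_mul_of_one_le_right (by positivity) (Real.one_le_exp ?_)
      rw [← mul_add]
      refine mul_nonneg ht.le ?_
      rw [doublingSum_coboundary]
      linarith [(abs_le.1 (hB (c n p))).2, (abs_le.1 (hB (2 ^ n * c n p))).1]
    · have : T n p = ∅ := by simp [T, hg]
      simp [this, hs0]
  have hn : ∀ n, ∑ p, Metric.ediam (T n p) ^ s ≤
      ENNReal.ofReal ((2 ^ s * Real.exp (t * (2 * B)) * q) * ((2⁻¹ : ℝ) ^ s * (2 * ρ)) ^ n) :=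
    fun n => by
    refine (Finset.sum_le_sum fun p _ => hterm n p).trans ?_
    rw [← ENNReal.ofReal_sum_of_nonneg (fun p _ => by positivity), ← Finset.mul_sum,
      Fintype.sum_prod_type]
    refine ENNReal.ofReal_le_ofReal ?_
    have hinner : ∀ i : Fin q, ∑ j : Fin (2 ^ n), Real.exp (t * doublingSum f n (c n (i, j))) ≤
        (2 * ρ) ^ n := fun i => by
      have := sum_exp_doublingSum_le fp hρ0 htρ n (((i : ℕ) : ℝ) / q)
      rwa [Finset.sum_range] at this
    have hsum := Finset.sum_le_card_nsmul Finset.univ _ _ fun i _ => hinner i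
    simp only [Finset.card_univ, Fintype.card_fin, nsmul_eq_mul] at hsum
    calc _ ≤ _ := mul_le_mul_of_nonneg_left hsum (by positivity)
      _ = _ := by rw [mul_pow]; ring
  have hdim : dimH {x ∈ Ico (0 : ℝ) 1 | ∃ᶠ n : ℕ in atTop, n * a < doublingSum F n x} ≤
      (NNReal.mk s hs0.le : ENNReal) := by
    refine dimH_le_of_frequently_cover T r ?_ ?_ hTr (s := NNReal.mk s hs0.le) hs0 ?_ ?_
    · intro m n hmn
      refine ENNReal.ofReal_le_ofReal (mul_le_mul_of_nonneg_left ?_ zero_le_two)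
      exact pow_le_pow_of_le_one (by norm_num) (by norm_num) hmn
    · rw [← ENNReal.ofReal_zero]
      refine ENNReal.tendsto_ofReal ?_
      simpa using (tendsto_pow_atTop_nhds_zero_of_lt_one (r := (2⁻¹ : ℝ)) (by norm_num)
        (by norm_num)).const_mul 2
    · refine ne_top_of_le_ne_top ?_ (ENNReal.tsum_le_tsum hn)
      rw [← ENNReal.ofReal_tsum_of_nonneg (fun n => by positivity)]
      · exact ENNReal.ofReal_ne_top
      · exact (summable_geometric_of_lt_one (by positivity) hsρ).mul_left _
    · rintro x ⟨hx, hfr⟩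
      refine hfr.mono fun n hnx => ?_
      obtain ⟨i, hi, j, hj, hij⟩ := exists_near_grid hx hq0' n
      refine ⟨(⟨i, hi⟩, ⟨j, hj⟩), ?_, ?_⟩
      · rw [Metric.mem_closedBall, Real.dist_eq]
        refine hij.trans ?_
        rw [inv_pow, div_eq_mul_inv]
        exact mul_le_of_le_one_left (by positivity) hq1
      · have hlt : 2 ^ n * |x - c n (⟨i, hi⟩, ⟨j, hj⟩)| < d := by
          refine lt_of_le_of_lt ?_ hqd
          have := mul_le_mul_of_nonneg_left hij (by positivity : (0 : ℝ) ≤ 2 ^ n)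
          rwa [mul_div_cancel₀ _ (by positivity)] at this
        have hosc := (abs_le.1 (abs_doublingSum_sub_le (fun a b hab => (hgd hab).le) hlt)).2
        have hg : doublingSum g n x = doublingSum F n x - n * (a - h) := by
          simp [doublingSum, g, Finset.sum_sub_distrib]; ring
        linarith
  exact hdim.trans_lt (by exact_mod_cast (show NNReal.mk s hs0.le < 1 from hs1))

lemma iterate_double_coe (n : ℕ) (x : ℝ) :
    (fun y : AddCircle (1 : ℝ) => y + y)^[n] (x : AddCircle (1 : ℝ)) = ((2 ^ n * x : ℝ) :) := by
  induction n with
  | zero => simp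
  | succ n ih =>
    rw [Function.iterate_succ_apply', ih, ← AddCircle.coe_add]; congr 1; ring

/-- The analogous bound for the orbits of the doubling map on the circle. -/
lemma dimH_frequently_lt_sum_iterate_double {φ : AddCircle (1 : ℝ) → ℝ} (hφ : Continuous φ)
    {a : ℝ} (ha : ∫ z, φ z < a) :
    dimH {y : AddCircle (1 : ℝ) | ∃ᶠ n : ℕ in atTop,
      n * a < ∑ i ∈ Finset.range n, φ ((fun y => y + y)^[i] y)} < 1 := by
  have hlip : LipschitzWith 1 (fun x : ℝ => (x : AddCircle (1 : ℝ))) :=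
    LipschitzWith.of_dist_le_mul fun x y => by
      rw [NNReal.coe_one, one_mul, dist_eq_norm, dist_eq_norm, ← AddCircle.coe_sub]
      exact QuotientAddGroup.norm_mk_le_norm
  obtain ⟨M, hM⟩ := isCompact_univ.exists_bound_of_continuousOn hφ.continuousOn
  have hI := AddCircle.intervalIntegral_preimage 1 0 φ
  rw [zero_add] at hI
  have key := dimH_frequently_lt_doublingSum (F := fun x : ℝ => φ x) (hφ.comp hlip.continuous)
    (fun x => by simp)
    ((CompactSpace.uniformContinuous_of_continuous hφ).comp hlip.uniformContinuous)
    (fun x => hM x (mem_univ _)) (hI.trans_lt ha)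
  refine (dimH_mono ?_).trans_lt ((hlip.dimH_image_le _).trans_lt key)
  intro y hy
  obtain ⟨x, hx, rfl⟩ : ∃ x ∈ Ico (0 : ℝ) 1, (x : AddCircle (1 : ℝ)) = y := by
    have := AddCircle.coe_image_Ico_eq (1 : ℝ) 0
    rw [zero_add] at this
    simpa using this.ge (mem_univ y)
  refine ⟨x, ⟨hx, ?_⟩, rfl⟩
  simpa [doublingSum, iterate_double_coe] using hy

end

/-- Weak ergodic theorem for the doubling map `ζ(y) = 2y` of the circle `S¹ = ℝ/ℤ`:
for any continuous `φ : S¹ → ℝ` and any `δ > 0`, the set of points `y` for which the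
sequence of partial time averages `φ_n(y) = (1/n) ∑_{i<n} φ(ζ^i y)` has a limit
(accumulation) point outside `[I - δ, I + δ]`, where `I = ∫ φ` is the space average with
respect to the normalized Haar (Lebesgue) measure, has Hausdorff dimension smaller than 1. -/
theorem weak_ergodic_doubling (φ : AddCircle (1 : ℝ) → ℝ) (hφ : Continuous φ)
    (δ : ℝ) (hδ : 0 < δ) :
    dimH {y : AddCircle (1 : ℝ) |
        ∃ c : ℝ, c ∉ Set.Icc ((∫ z, φ z) - δ) ((∫ z, φ z) + δ) ∧
          MapClusterPt c atTop
            (fun n : ℕ => (n : ℝ)⁻¹ * ∑ i ∈ Finset.range n, φ ((fun y => y + y)^[i] y))} <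
      1 := by
  have h1 := dimH_frequently_lt_sum_iterate_double hφ (a := (∫ z, φ z) + δ) (by linarith)
  have h2 := dimH_frequently_lt_sum_iterate_double (φ := fun y => -φ y) hφ.neg
    (a := -(∫ z, φ z) + δ) (by rw [integral_neg]; linarith)
  refine (dimH_mono ?_).trans_lt ((dimH_union _ _).trans_lt (max_lt h1 h2))
  rintro y ⟨c, hc, hcl⟩
  rw [Set.mem_Icc, not_and_or, not_le, not_le] at hc
  rcases hc with hc | hc
  · right
    refine ((hcl.frequently (gt_mem_nhds hc)).and_eventually (eventually_gt_atTop 0)).mono ?_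
    rintro n ⟨hn, hn0⟩
    have hn0' : (0 : ℝ) < n := by exact_mod_cast hn0
    rw [inv_mul_lt_iff₀ hn0'] at hn
    rw [Finset.sum_neg_distrib]
    linarith
  · left
    refine ((hcl.frequently (lt_mem_nhds hc)).and_eventually (eventually_gt_atTop 0)).mono ?_
    rintro n ⟨hn, hn0⟩
    have hn0' : (0 : ℝ) < n := by exact_mod_cast hn0
    rwa [lt_inv_mul_iff₀ hn0'] at hn
end

section
/- Let E be a finite-dimensional real normed vector space, let z ∈ E and δ > 0, and let f : E → E be a map which is continuous on the closed ball B̄(z, δ) and satisfies ‖f(x) − x‖ ≤ δ/2 for every x ∈ B̄(z, δ). Then z belongs to the image f(B̄(z, δ)); that is, there exists x̃ ∈ B̄(z, δ) with f(x̃) = z. -/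
open MeasureTheory Metric

theorem exists_lagrange_det_one_add_smul (V : Type*) [NormedAddCommGroup V] [NormedSpace ℝ V]
    [FiniteDimensional ℝ V] {ε : ℝ} (hε : 0 < ε) :
    ∃ (s : Finset ℝ) (c : ℝ → ℝ), (∀ t ∈ s, 0 < t ∧ t < ε) ∧ ∑ t ∈ s, c t = 1 ∧
      ∀ A : V →L[ℝ] V, ∑ t ∈ s, c t * (1 + t • A).det = (1 + A).det := by
  classical
  obtain ⟨s, hs, hcard⟩ := (Set.Ioo_infinite hε).exists_subset_card_eq (Module.finrank ℝ V + 1)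
  have hinj : Set.InjOn (id : ℝ → ℝ) s := Function.injective_id.injOn
  have hne : s.Nonempty := Finset.card_pos.mp (by omega)
  refine ⟨s, fun t => (Lagrange.basis s id t).eval 1, fun t ht => hs ht, ?_, fun A => ?_⟩
  · rw [← Polynomial.eval_finsetSum, Lagrange.sum_basis hinj hne, Polynomial.eval_one]
  · let b := Module.finBasis ℝ V
    let M : Matrix (Fin (Module.finrank ℝ V)) (Fin (Module.finrank ℝ V)) ℝ :=
      LinearMap.toMatrix b b (A : V →ₗ[ℝ] V)
    let p : Polynomial ℝ :=
      ((Polynomial.X : Polynomial ℝ) • M.map (Polynomial.C : ℝ →+* Polynomial ℝ) +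
        (1 : Matrix (Fin (Module.finrank ℝ V)) (Fin (Module.finrank ℝ V)) ℝ).map
          (Polynomial.C : ℝ →+* Polynomial ℝ)).det
    have hp : ∀ t : ℝ, p.eval t = (1 + t • A).det := by
      intro t
      have h1 : ((1 + t • A : V →L[ℝ] V) : V →ₗ[ℝ] V) = Matrix.toLin b b (1 + t • M) := by
        simp [M, Matrix.toLin_one]
        rfl
      rw [ContinuousLinearMap.det, h1, LinearMap.det_toLin]
      simp only [p]
      rw [← Polynomial.coe_evalRingHom, RingHom.map_det]
      congr 1
      ext i j
      by_cases hij : i = j <;> simp [hij, add_comm, mul_comm t]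
    have hdeg : p.degree < s.card := by
      refine lt_of_le_of_lt (Polynomial.degree_le_of_natDegree_le
        (Polynomial.natDegree_det_X_add_C_le M 1)) ?_
      rw [hcard, Fintype.card_fin]
      exact_mod_cast Nat.lt_succ_self _
    have h := congrArg (Polynomial.eval 1) (Lagrange.eq_interpolate hinj hdeg)
    rw [hp, one_smul, Lagrange.interpolate_apply, Polynomial.eval_finsetSum] at h
    rw [h]
    refine Finset.sum_congr rfl fun t _ => ?_
    rw [Polynomial.eval_mul, Polynomial.eval_C, hp, id, mul_comm]

theorem LipschitzWith.bijective_add_of_lt_one {V : Type*} [NormedAddCommGroup V] [CompleteSpace V]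
    {v : V → V} {c : NNReal} (hv : LipschitzWith c v) (hc : c < 1) :
    Function.Bijective fun x => x + v x := by
  constructor
  · intro x y hxy
    have h : dist x y ≤ c * dist x y := by
      have h1 : x - y = v y - v x := by
        rw [sub_eq_sub_iff_add_eq_add, add_comm (v y)]
        exact hxy
      calc dist x y = dist (v y) (v x) := by rw [dist_eq_norm, dist_eq_norm, h1]
        _ ≤ c * dist x y := by rw [dist_comm x y]; exact hv.dist_le_mul y x
    have hc' : (c : ℝ) < 1 := hc
    have := dist_nonneg (x := x) (y := y)
    exact dist_le_zero.mp (by nlinarith)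
  · intro p
    have hcontr : ContractingWith c fun x => p - v x :=
      ⟨hc, LipschitzWith.of_dist_le_mul fun x y => by
        rw [dist_sub_left]; exact hv.dist_le_mul x y⟩
    refine ⟨hcontr.fixedPoint, ?_⟩
    have := hcontr.fixedPoint_isFixedPt
    exact (sub_eq_iff_eq_add.mp this.eq).symm

theorem LipschitzOnWith.indicator_of_eq_zero_frontier {V W : Type*} [NormedAddCommGroup V]
    [NormedSpace ℝ V] [NormedAddCommGroup W] {s : Set V} {u : V → W} {K : NNReal}
    (hs : IsClosed s) (hu : LipschitzOnWith K u s) (h0 : ∀ x ∈ frontier s, u x = 0) :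
    LipschitzWith K (s.indicator u) := by
  have key : ∀ x ∈ s, ∀ y ∉ s, dist (s.indicator u x) (s.indicator u y) ≤ K * dist x y := by
    intro x hx y hy
    obtain ⟨w, hw, hws⟩ : ∃ w ∈ segment ℝ x y, w ∈ frontier s := by
      by_contra! hfr
      have hint : ∀ w ∈ segment ℝ x y, w ∈ s → w ∈ interior s := fun w hw hws => by
        by_contra hwi
        exact hfr w hw (hs.frontier_eq ▸ ⟨hws, hwi⟩)
      obtain ⟨w, -, hwi, hwc⟩ := (convex_segment (𝕜 := ℝ) x y).isPreconnected (interior s) sᶜ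
        isOpen_interior hs.isOpen_compl
        (fun w hw => (em (w ∈ s)).imp (hint w hw) id)
        ⟨x, left_mem_segment ℝ x y, hint x (left_mem_segment ℝ x y) hx⟩
        ⟨y, right_mem_segment ℝ x y, hy⟩
      exact hwc (interior_subset hwi)
    rw [Set.indicator_of_mem hx, Set.indicator_of_notMem hy, ← h0 w hws]
    refine (hu.dist_le_mul x hx w (hs.frontier_subset hws)).trans ?_
    gcongr
    rw [← dist_add_dist_of_mem_segment hw]
    exact le_add_of_nonneg_right dist_nonneg
  refine LipschitzWith.of_dist_le_mul fun x y => ?_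
  by_cases hx : x ∈ s <;> by_cases hy : y ∈ s
  · simpa [hx, hy] using hu.dist_le_mul x hx y hy
  · exact key x hx y hy
  · rw [dist_comm, dist_comm x]; exact key y hy x hx
  · simp [hx, hy]; positivity

theorem MeasureTheory.setIntegral_det_one_add_fderiv_eq_measureReal {V : Type*}
    [NormedAddCommGroup V] [NormedSpace ℝ V] [FiniteDimensional ℝ V] [MeasurableSpace V]
    [BorelSpace V] (μ : Measure V) [μ.IsAddHaarMeasure] {s : Set V} (hs : IsCompact s)
    (hconv : Convex ℝ s) {u : V → V} (hu : ∀ x ∈ s, ContDiffAt ℝ 1 u x)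
    (h0 : ∀ x ∈ frontier s, u x = 0) :
    ∫ x in s, (1 + fderiv ℝ u x).det ∂μ = μ.real s := by
  have hdiff : ∀ x ∈ s, DifferentiableAt ℝ u x := fun x hx =>
    (hu x hx).differentiableAt one_ne_zero
  have hcont : ContinuousOn (fderiv ℝ u) s := fun x hx =>
    ((hu x hx).continuousAt_fderiv one_ne_zero).continuousWithinAt
  obtain ⟨C, hC⟩ := hs.exists_bound_of_continuousOn hcont
  let K : NNReal := C.toNNReal
  have hK : ∀ x ∈ s, ‖fderiv ℝ u x‖ ≤ K := fun x hx => (hC x hx).trans C.le_coe_toNNReal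
  have hlip := (hconv.lipschitzOnWith_of_nnnorm_fderiv_le hdiff hK).indicator_of_eq_zero_frontier
    hs.isClosed h0
  obtain ⟨η, hη, hdet⟩ : ∃ η > 0, ∀ A : V →L[ℝ] V, ‖A‖ < η → 0 < (1 + A).det := by
    have h1 : ContinuousAt (fun A : V →L[ℝ] V => (1 + A).det) 0 :=
      (ContinuousLinearMap.continuous_det.comp (continuous_const.add continuous_id)).continuousAt
    have h2 : 0 < (1 + (0 : V →L[ℝ] V)).det := by
      rw [add_zero, ContinuousLinearMap.det]
      exact (LinearMap.det_id (M := V) (A := ℝ)).symm ▸ one_pos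
    obtain ⟨η, hη, h⟩ := Metric.eventually_nhds_iff.mp (h1.eventually_const_lt h2)
    exact ⟨η, hη, fun A hA => h (by rwa [dist_zero_right])⟩
  have hpos : 0 < min 1 η / (K + 1) := by positivity
  obtain ⟨T, c, hT, hc, hsum⟩ := exists_lagrange_det_one_add_smul V hpos
  have hsmall : ∀ t ∈ T, ∫ x in s, (1 + t • fderiv ℝ u x).det ∂μ = μ.real s := by
    intro t ht
    obtain ⟨ht0, ht1⟩ := hT t ht
    have htK : t * K < min 1 η := by
      rw [lt_div_iff₀ (by positivity)] at ht1
      linarith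
    have hbij := (((lipschitzWith_smul t).comp hlip)).bijective_add_of_lt_one (by
      rw [← NNReal.coe_lt_coe]
      simpa [abs_of_pos ht0] using htK.trans_le (min_le_left _ _))
    have himage : (fun x => x + t • u x) '' s = s := by
      have h1 : (fun x => x + t • s.indicator u x) '' sᶜ = sᶜ := by
        rw [Set.image_congr (g := id), Set.image_id]
        intro x hx
        simp [Set.indicator_of_notMem hx]
      have h2 := Set.image_compl_eq (s := s) hbij
      have h3 : (fun x => x + t • s.indicator u x) '' s = (fun x => x + t • u x) '' s :=
        Set.image_congr fun x hx => by simp [Set.indicator_of_mem hx]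
      rw [← h3]
      exact compl_injective (h2.symm.trans h1)
    have hinj : Set.InjOn (fun x => x + t • u x) s := by
      refine hbij.injective.injOn.congr fun x hx => ?_
      simp [Set.indicator_of_mem hx]
    have h := integral_image_eq_integral_abs_det_fderiv_smul μ hs.measurableSet
      (f := fun x => x + t • u x) (f' := fun x => 1 + t • fderiv ℝ u x)
      (fun x hx => ((hasFDerivAt_id x).add
        ((hdiff x hx).hasFDerivAt.const_smul t)).hasFDerivWithinAt) hinj (fun _ => (1 : ℝ))
    rw [himage] at h
    simp only [smul_eq_mul, mul_one, integral_const, MeasurableSet.univ, measureReal_restrict_apply,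
      Set.univ_inter] at h
    rw [h]
    refine setIntegral_congr_fun hs.measurableSet fun x hx => (abs_of_pos (hdet _ ?_)).symm
    rw [norm_smul, Real.norm_of_nonneg ht0.le]
    exact (mul_le_mul_of_nonneg_left (hK x hx) ht0.le).trans_lt (htK.trans_le (min_le_right _ _))
  have hint : ∀ t ∈ T, IntegrableOn (fun x => c t * (1 + t • fderiv ℝ u x).det) s μ :=
    fun t _ => ContinuousOn.integrableOn_compact hs (continuousOn_const.mul
      (ContinuousLinearMap.continuous_det.comp_continuousOn
        (continuousOn_const.add (hcont.const_smul t))))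
  calc ∫ x in s, (1 + fderiv ℝ u x).det ∂μ
      = ∫ x in s, ∑ t ∈ T, c t * (1 + t • fderiv ℝ u x).det ∂μ := by simp only [hsum]
    _ = ∑ t ∈ T, c t * μ.real s := by
      rw [integral_finsetSum _ hint]
      exact Finset.sum_congr rfl fun t ht => by rw [integral_const_mul, hsmall t ht]
    _ = μ.real s := by rw [← Finset.sum_mul, hc, one_mul]

theorem exists_norm_add_ne_of_eq_zero_on_sphere {V : Type*} [NormedAddCommGroup V]
    [InnerProductSpace ℝ V] [FiniteDimensional ℝ V] {R : ℝ} (hR : 0 < R) {u : V → V}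
    (hu : ∀ x ∈ closedBall (0 : V) R, ContDiffAt ℝ 1 u x) (h0 : ∀ x ∈ sphere (0 : V) R, u x = 0) :
    ∃ x ∈ closedBall (0 : V) R, ‖x + u x‖ ≠ R := by
  by_contra! hnorm
  borelize V
  let μ : Measure V := Measure.addHaar
  have h := setIntegral_det_one_add_fderiv_eq_measureReal μ (isCompact_closedBall (0 : V) R)
    (convex_closedBall 0 R) hu (by rwa [frontier_closedBall _ hR.ne'])
  have hdet : ∀ x ∈ ball (0 : V) R, (1 + fderiv ℝ u x).det = 0 := by
    intro x hx
    by_contra hne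
    have hd : HasFDerivAt (fun y => y + u y) (1 + fderiv ℝ u x) x := (hasFDerivAt_id x).add
      ((hu x (ball_subset_closedBall hx)).differentiableAt one_ne_zero).hasFDerivAt
    have hsq := hd.norm_sq
    have hconst : (fun y => ‖y + u y‖ ^ 2) =ᶠ[nhds x] fun _ => R ^ 2 := by
      filter_upwards [isOpen_ball.mem_nhds hx] with y hy
      rw [hnorm y (ball_subset_closedBall hy)]
    have hzero := hsq.unique ((hasFDerivAt_const (R ^ 2) x).congr_of_eventuallyEq hconst)
    obtain ⟨v, hv⟩ := ((LinearMap.equivOfDetNeZero _ hne).surjective (x + u x))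
    have hv' : (1 + fderiv ℝ u x) v = x + u x := hv
    have h2 := congrArg (fun L : V →L[ℝ] ℝ => L v) hzero
    simp only [smul_apply, ContinuousLinearMap.comp_apply, hv',
      innerSL_apply_apply, real_inner_self_eq_norm_sq, hnorm x (ball_subset_closedBall hx)] at h2
    simp at h2
    exact hR.ne' h2
  have hball : closedBall (0 : V) R =ᵐ[μ] ball 0 R := by
    rw [ae_eq_set, closedBall_sdiff_ball, Set.sdiff_eq_empty.mpr ball_subset_closedBall]
    exact ⟨Measure.addHaar_sphere_of_ne_zero μ 0 hR.ne', measure_empty⟩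
  rw [setIntegral_congr_set hball, setIntegral_congr_fun measurableSet_ball hdet,
    integral_zero] at h
  have hpos : 0 < μ.real (closedBall (0 : V) R) :=
    ENNReal.toReal_pos (measure_closedBall_pos μ 0 hR).ne' measure_closedBall_lt_top.ne
  exact hpos.ne h

theorem exists_fixedPoint_of_contDiff_of_norm_lt {V : Type*} [NormedAddCommGroup V]
    [InnerProductSpace ℝ V] [FiniteDimensional ℝ V] {R : ℝ} {g : V → V}
    (hg : ContDiff ℝ 1 g) (hgR : ∀ x, ‖g x‖ < R) : ∃ x, g x = x := by
  by_contra! hne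
  have hR : 0 < R := (norm_nonneg _).trans_lt (hgR 0)
  let w : V → V := fun x => x - g x
  have hw : ContDiff ℝ 1 w := contDiff_id.sub hg
  have hw0 : ∀ x, 0 < ‖w x‖ ^ 2 := fun x =>
    pow_pos (norm_pos_iff.mpr (sub_ne_zero.mpr (hne x).symm)) 2
  let b : V → ℝ := fun x => inner ℝ x (w x)
  have hb : ContDiff ℝ 1 b := contDiff_id.inner ℝ hw
  let D : V → ℝ := fun x => b x ^ 2 + ‖w x‖ ^ 2 * (R ^ 2 - ‖x‖ ^ 2)
  have hD : ContDiff ℝ 1 D :=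
    (hb.pow 2).add ((hw.norm_sq ℝ).mul (contDiff_const.sub (contDiff_id.norm_sq ℝ)))
  have hb_sphere : ∀ x, ‖x‖ = R → 0 < b x := by
    intro x hx
    have h1 : b x = R ^ 2 - inner ℝ x (g x) := by
      simp only [b, w, inner_sub_right, real_inner_self_eq_norm_sq, hx]
    have h2 := real_inner_le_norm x (g x)
    rw [hx] at h2
    nlinarith [hgR x]
  have hDpos : ∀ x ∈ closedBall (0 : V) R, 0 < D x := by
    intro x hx
    rw [mem_closedBall_zero_iff] at hx
    rcases hx.lt_or_eq with h | h
    · have : 0 < R ^ 2 - ‖x‖ ^ 2 := sub_pos.mpr (pow_lt_pow_left₀ h (norm_nonneg x) two_ne_zero)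
      exact add_pos_of_nonneg_of_pos (sq_nonneg _) (mul_pos (hw0 x) this)
    · simpa [D, h] using pow_pos (hb_sphere x h) 2
  let u : V → V := fun x => ((-b x + √(D x)) / ‖w x‖ ^ 2) • w x
  have hu : ∀ x ∈ closedBall (0 : V) R, ContDiffAt ℝ 1 u x := fun x hx =>
    ((hb.contDiffAt.neg.add (hD.contDiffAt.sqrt (hDpos x hx).ne')).div
      (hw.norm_sq ℝ).contDiffAt (hw0 x).ne').smul hw.contDiffAt
  have hu0 : ∀ x ∈ sphere (0 : V) R, u x = 0 := by
    intro x hx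
    rw [mem_sphere_zero_iff_norm] at hx
    have : √(D x) = b x := by simp [D, hx, Real.sqrt_sq (hb_sphere x hx).le]
    simp [u, this]
  obtain ⟨x, hx, hxR⟩ := exists_norm_add_ne_of_eq_zero_on_sphere hR hu hu0
  apply hxR
  rw [← sq_eq_sq₀ (norm_nonneg _) hR.le, norm_add_sq_real]
  have hq : √(D x) ^ 2 = b x ^ 2 + ‖w x‖ ^ 2 * (R ^ 2 - ‖x‖ ^ 2) := Real.sq_sqrt (hDpos x hx).le
  have hbx : inner ℝ x (w x) = b x := rfl
  have hwx : ‖w x‖ ≠ 0 := fun h => (hw0 x).ne' (by rw [h, zero_pow two_ne_zero])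
  simp only [u, inner_smul_right, norm_smul, mul_pow, Real.norm_eq_abs, sq_abs, hbx]
  field_simp
  linear_combination hq

/-- **Brouwer's fixed point theorem** for continuous self-maps of bounded range. -/
theorem Continuous.exists_fixedPoint_of_norm_le {V : Type*} [NormedAddCommGroup V]
    [InnerProductSpace ℝ V] [FiniteDimensional ℝ V] {M : ℝ} {g : V → V}
    (hg : Continuous g) (hgM : ∀ x, ‖g x‖ ≤ M) : ∃ x, g x = x := by
  by_contra! hne
  have hM : 0 ≤ M := (norm_nonneg _).trans (hgM 0)
  obtain ⟨y, -, hy⟩ := (isCompact_closedBall (0 : V) (M + 1)).exists_isMinOn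
    ⟨0, mem_closedBall_self (by positivity)⟩ (hg.dist continuous_id).continuousOn
  have hη : 0 < min 1 (dist (g y) y) := lt_min one_pos (dist_pos.mpr (hne y))
  obtain ⟨g', hg', happrox, -⟩ := hg.exists_contDiff_approx 1
    (ε := fun _ => min 1 (dist (g y) y)) continuous_const fun _ => hη
  have hg'M : ∀ x, ‖g' x‖ < M + 1 := fun x => by
    have h1 := (happrox x).trans_le (min_le_left _ _)
    rw [dist_eq_norm] at h1
    linarith [norm_le_norm_add_norm_sub' (g' x) (g x), hgM x]
  obtain ⟨x, hx⟩ := exists_fixedPoint_of_contDiff_of_norm_lt (by exact_mod_cast hg') hg'M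
  have hxM : x ∈ closedBall (0 : V) (M + 1) := by
    rw [mem_closedBall_zero_iff, ← hx]
    exact (hg'M x).le
  have h1 : dist (g y) y ≤ dist (g x) x := hy hxM
  have h2 := (happrox x).trans_le (min_le_right _ _)
  rw [hx, dist_comm] at h2
  exact h1.not_gt h2

/-- Degree/index argument: if `E` is a finite-dimensional real normed vector space and
`f : E → E` is continuous on the closed ball `B̄(z, δ)` and moves every point of that ball
by at most `δ/2`, then `z` is in the image of the closed ball under `f`. -/
theorem center_mem_image_of_small_displacement (E : Type*) [NormedAddCommGroup E]
    [NormedSpace ℝ E] [FiniteDimensional ℝ E] (z : E) (δ : ℝ) (hδ : 0 < δ) (f : E → E)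
    (hf : ContinuousOn f (Metric.closedBall z δ))
    (hclose : ∀ x ∈ Metric.closedBall z δ, ‖f x - x‖ ≤ δ / 2) :
    ∃ x ∈ Metric.closedBall z δ, f x = z := by
  let r : E → E := fun x => z + (δ / max δ ‖x - z‖) • (x - z)
  have hmax : ∀ x, 0 < max δ ‖x - z‖ := fun x => hδ.trans_le (le_max_left _ _)
  have hr : Continuous r := continuous_const.add ((continuous_const.div
    (continuous_const.max (continuous_id.sub continuous_const).norm) fun x => (hmax x).ne').smul
    (continuous_id.sub continuous_const))
  have hrmem : ∀ x, r x ∈ closedBall z δ := by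
    intro x
    rw [mem_closedBall_iff_norm]
    simp only [r, add_sub_cancel_left, norm_smul, norm_div, Real.norm_of_nonneg hδ.le,
      Real.norm_of_nonneg (hmax x).le]
    rw [div_mul_eq_mul_div, div_le_iff₀ (hmax x)]
    exact mul_le_mul_of_nonneg_left (le_max_right _ _) hδ.le
  let g : E → E := fun x => z + (r x - f (r x))
  have hg : Continuous g :=
    continuous_const.add (hr.sub (hf.comp_continuous hr hrmem))
  have hgmem : ∀ x, g x ∈ closedBall z δ := fun x => by
    rw [mem_closedBall_iff_norm, add_sub_cancel_left, norm_sub_rev]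
    exact (hclose _ (hrmem x)).trans (half_le_self hδ.le)
  let e := toEuclidean (E := E)
  obtain ⟨M, hM⟩ := (((isCompact_closedBall z δ).image e.continuous).isBounded).exists_norm_le
  obtain ⟨y, hy⟩ := (e.continuous.comp (hg.comp e.symm.continuous)).exists_fixedPoint_of_norm_le
    fun x => hM _ (Set.mem_image_of_mem e (hgmem (e.symm x)))
  let x := e.symm y
  have hx : g x = x := e.injective (by simpa [x] using hy)
  have hxmem : x ∈ closedBall z δ := hx ▸ hgmem x
  have hrx : r x = x := by
    rw [mem_closedBall_iff_norm] at hxmem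
    simp [r, max_eq_left hxmem, hδ.ne']
  refine ⟨x, hxmem, ?_⟩
  simp only [g, hrx] at hx
  rw [add_sub_left_comm, add_eq_left, sub_eq_zero] at hx
  exact hx.symm
end
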